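/- Let n ≥ 1 and let f : Z_2^n → Z_2 with minimum influence γ_f > 0. Consider i.i.d. samples u_1, u_2, … drawn from the distribution D on Z_2^n with D(u) = (F̂(u))². Then for every i ≥ 1 and every realization of u_1, …, u_i with Span{u_1, …, u_i} ≠ Z_2^n, the conditional probability that u_{i+1} ∉ Span{u_1, …, u_i} is at least γ_f; consequently, the expected number of samples until Span{u_1, …, u_t} = Z_2^n is at most n/γ_f. -/

import Mathlib

/-- The Fourier coefficient of `F(x) = (-1)^{f(x)}` at `u`:
`F̂(u) = 2^{-n} ∑_x (-1)^{f(x)} (-1)^{⟨u,x⟩}`. -/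
noncomputable def boolFourierCoeff (n : ℕ) (f : (Fin n → ZMod 2) → ZMod 2)
    (u : Fin n → ZMod 2) : ℝ :=
  (2 ^ n : ℝ)⁻¹ *
    ∑ x : Fin n → ZMod 2,
      (-1 : ℝ) ^ (f x).val * (-1 : ℝ) ^ (∑ i, u i * x i : ZMod 2).val

/-- The influence of `v` over `f`: `γ_{f,v} = |{x : f(x) ≠ f(x+v)}| / 2^n`. -/
noncomputable def influence (n : ℕ) (f : (Fin n → ZMod 2) → ZMod 2)
    (v : Fin n → ZMod 2) : ℝ :=
  ((Finset.univ.filter fun x : Fin n → ZMod 2 => f x ≠ f (x + v)).card : ℝ) / 2 ^ n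

/-- The minimum influence over `f`: `γ_f = min_{v ≠ 0} γ_{f,v}`. -/
noncomputable def minInfluence (n : ℕ) (hn : 1 ≤ n)
    (f : (Fin n → ZMod 2) → ZMod 2) : ℝ :=
  (Finset.univ.filter fun v : Fin n → ZMod 2 => v ≠ 0).inf'
    (Finset.filter_nonempty_iff.mpr
      ⟨fun _ => 1, Finset.mem_univ _, fun h => by simpa using congrFun h ⟨0, hn⟩⟩)
    (influence n f)

/-- The character `a ↦ (-1)^a` of `ZMod 2` is multiplicative. -/
theorem neg_one_pow_val_add (a b : ZMod 2) :
    (-1 : ℝ) ^ (a + b).val = (-1) ^ a.val * (-1) ^ b.val := by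
  rw [← pow_add, ZMod.val_add, ← neg_one_pow_eq_pow_mod_two]

theorem sum_neg_one_pow_dotProduct {n : ℕ} (z : Fin n → ZMod 2) :
    ∑ w : Fin n → ZMod 2, (-1 : ℝ) ^ (w ⬝ᵥ z).val = if z = 0 then 2 ^ n else 0 := by
  split_ifs with hz
  · simp [hz, ZMod.card]
  · obtain ⟨i, hi⟩ := Function.ne_iff.mp hz
    have hi : z i = 1 := (by decide : ∀ a : ZMod 2, a ≠ 0 → a = 1) _ hi
    have h := Equiv.sum_comp (Equiv.addRight (Pi.single i 1 : Fin n → ZMod 2))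
      fun w : Fin n → ZMod 2 => (-1 : ℝ) ^ (w ⬝ᵥ z).val
    simp only [Equiv.coe_addRight, add_dotProduct, neg_one_pow_val_add, single_dotProduct, hi,
      mul_one, ZMod.val_one, pow_one, mul_neg, Finset.sum_neg_distrib] at h
    linarith

/-- The Fourier transform of `F̂²` is the autocorrelation of `F`. -/
theorem sum_boolFourierCoeff_sq_mul (n : ℕ) (f : (Fin n → ZMod 2) → ZMod 2)
    (v : Fin n → ZMod 2) :
    ∑ w, boolFourierCoeff n f w ^ 2 * (-1 : ℝ) ^ (w ⬝ᵥ v).val =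
      (2 ^ n : ℝ)⁻¹ * ∑ x, (-1 : ℝ) ^ (f x).val * (-1) ^ (f (x + v)).val := by
  have hzero (x y : Fin n → ZMod 2) : x + y + v = 0 ↔ x + v = y := by
    rw [add_right_comm, add_eq_zero_iff_eq_neg, ZModModule.neg_eq_self]
  have hexp (w : Fin n → ZMod 2) :
      boolFourierCoeff n f w ^ 2 * (-1 : ℝ) ^ (w ⬝ᵥ v).val =
        ∑ x, ∑ y, (2 ^ n : ℝ)⁻¹ ^ 2 * ((-1 : ℝ) ^ (f x).val * (-1) ^ (f y).val) *
          (-1) ^ (w ⬝ᵥ (x + y + v)).val := by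
    change ((2 ^ n : ℝ)⁻¹ * ∑ x, (-1 : ℝ) ^ (f x).val * (-1) ^ (w ⬝ᵥ x).val) ^ 2 * _ = _
    rw [mul_pow, sq (∑ x, _), Finset.sum_mul_sum, Finset.mul_sum, Finset.sum_mul]
    refine Finset.sum_congr rfl fun x _ => ?_
    rw [Finset.mul_sum, Finset.sum_mul]
    refine Finset.sum_congr rfl fun y _ => ?_
    simp only [dotProduct_add, neg_one_pow_val_add]
    ring
  simp_rw [hexp]
  rw [Finset.sum_comm, Finset.mul_sum]
  refine Finset.sum_congr rfl fun x _ => ?_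
  rw [Finset.sum_comm]
  simp_rw [← Finset.mul_sum, sum_neg_one_pow_dotProduct, hzero, mul_ite, mul_zero]
  rw [Finset.sum_ite_eq, if_pos (Finset.mem_univ _)]
  field_simp

/-- Parseval's identity. -/
theorem sum_boolFourierCoeff_sq (n : ℕ) (f : (Fin n → ZMod 2) → ZMod 2) :
    ∑ w, boolFourierCoeff n f w ^ 2 = 1 := by
  simpa [← pow_add, ← two_mul, ZMod.card] using sum_boolFourierCoeff_sq_mul n f 0

theorem autocorrelation_eq_one_sub_influence (n : ℕ) (f : (Fin n → ZMod 2) → ZMod 2)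
    (v : Fin n → ZMod 2) :
    (2 ^ n : ℝ)⁻¹ * ∑ x, (-1 : ℝ) ^ (f x).val * (-1) ^ (f (x + v)).val =
      1 - 2 * influence n f v := by
  have hbit : ∀ a : ZMod 2, a = 0 ∨ a = 1 := by decide
  have hpt (a b : ZMod 2) :
      (-1 : ℝ) ^ a.val * (-1) ^ b.val = 1 - 2 * if a ≠ b then 1 else 0 := by
    obtain rfl | rfl := hbit a <;> obtain rfl | rfl := hbit b <;> norm_num [ZMod.val_one]
  simp_rw [hpt, Finset.sum_sub_distrib, ← Finset.mul_sum, Finset.sum_boole, influence]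
  simp [ZMod.card]
  field_simp

/-- The Fourier mass off the hyperplane orthogonal to `v` is the influence of `v`. -/
theorem sum_boolFourierCoeff_sq_dotProduct_ne_zero (n : ℕ) (f : (Fin n → ZMod 2) → ZMod 2)
    (v : Fin n → ZMod 2) :
    ∑ w with w ⬝ᵥ v ≠ 0, boolFourierCoeff n f w ^ 2 = influence n f v := by
  have hpt (a : ZMod 2) (c : ℝ) : (if a ≠ 0 then c else 0) = (c - c * (-1) ^ a.val) / 2 := by
    obtain rfl | rfl := (by decide : ∀ a : ZMod 2, a = 0 ∨ a = 1) a <;> norm_num [ZMod.val_one]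
  simp_rw [Finset.sum_filter, hpt]
  rw [← Finset.sum_div, Finset.sum_sub_distrib, sum_boolFourierCoeff_sq,
    sum_boolFourierCoeff_sq_mul, autocorrelation_eq_one_sub_influence]
  ring

theorem exists_ne_zero_forall_mem_dotProduct_eq_zero {K ι : Type*} [Field K] [Fintype ι]
    {S : Submodule K (ι → K)} (hS : S ≠ ⊤) : ∃ v : ι → K, v ≠ 0 ∧ ∀ w ∈ S, w ⬝ᵥ v = 0 := by
  classical
  obtain ⟨φ, hφ, hker⟩ := S.exists_le_ker_of_lt_top hS.lt_top
  have hφv (w : ι → K) : w ⬝ᵥ (fun i => φ (Pi.single i 1)) = φ w := by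
    rw [LinearMap.pi_apply_eq_sum_univ φ w]
    refine Finset.sum_congr rfl fun i _ => ?_
    simp only [smul_eq_mul]
    congr 2
    ext j
    simp [Pi.single_apply, eq_comm]
  refine ⟨fun i => φ (Pi.single i 1), fun h => hφ ?_, fun w hw => (hφv w).trans (hker hw)⟩
  ext1 i
  ext
  simpa using congrFun h i

open scoped Classical in
/-- The Fourier mass off a proper subspace is at least the minimum influence. -/
theorem minInfluence_le_sum_notMem (n : ℕ) (hn : 1 ≤ n) (f : (Fin n → ZMod 2) → ZMod 2)
    {S : Submodule (ZMod 2) (Fin n → ZMod 2)} (hS : S ≠ ⊤) :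
    minInfluence n hn f ≤ ∑ w with w ∉ S, boolFourierCoeff n f w ^ 2 := by
  obtain ⟨v, hv, hvS⟩ := exists_ne_zero_forall_mem_dotProduct_eq_zero hS
  calc minInfluence n hn f ≤ influence n f v := Finset.inf'_le _ (by simpa using hv)
    _ = ∑ w with w ⬝ᵥ v ≠ 0, boolFourierCoeff n f w ^ 2 :=
      (sum_boolFourierCoeff_sq_dotProduct_ne_zero n f v).symm
    _ ≤ ∑ w with w ∉ S, boolFourierCoeff n f w ^ 2 := by
      refine Finset.sum_le_sum_of_subset_of_nonneg (fun w hw => ?_) fun _ _ _ => sq_nonneg _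
      simp only [Finset.mem_filter, Finset.mem_univ, true_and] at hw ⊢
      exact fun hwS => hw (hvS w hwS)

section ExpectedRank

open scoped Classical
open Module

variable {K V : Type*} [Field K] [AddCommGroup V] [Module K V] [FiniteDimensional K V]

theorem finrank_span_add_le_finrank_span_cons {t : ℕ} (w : V)
    (u : Fin t → V) :
    finrank K (Submodule.span K (Set.range u)) +
        (if w ∉ Submodule.span K (Set.range u) then 1 else 0) ≤
      finrank K (Submodule.span K (Set.range (Fin.cons w u : Fin (t + 1) → V))) := by
  rw [Fin.range_cons]
  have hle := Submodule.span_mono (R := K) (Set.subset_insert w (Set.range u))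
  by_cases h : w ∈ Submodule.span K (Set.range u)
  · simpa [h] using Submodule.finrank_mono hle
  · rw [if_pos h]
    refine Submodule.finrank_lt_finrank_of_lt (lt_of_le_of_ne hle fun heq => h ?_)
    rw [heq]
    exact Submodule.subset_span (Set.mem_insert w _)

variable [Fintype V] {D : V → ℝ} {γ : ℝ}

/-- The expected rank after `t + 1` samples exceeds that after `t` samples by at least `γ`
times the probability of not spanning after `t` samples. -/
theorem expected_finrank_span_succ (hD : ∀ w, 0 ≤ D w)
    (hD1 : ∑ w, D w = 1)
    (hγ : ∀ S : Submodule K V, S ≠ ⊤ → γ ≤ ∑ w with w ∉ S, D w) (t : ℕ) :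
    ∑ u : Fin t → V, (∏ i, D (u i)) * finrank K (Submodule.span K (Set.range u)) +
        γ * ∑ u : Fin t → V with Submodule.span K (Set.range u) ≠ ⊤, ∏ i, D (u i) ≤
      ∑ u : Fin (t + 1) → V, (∏ i, D (u i)) * finrank K (Submodule.span K (Set.range u)) := by
  rw [← (Fin.consEquiv fun _ : Fin (t + 1) => V).sum_comp, Fintype.sum_prod_type_right,
    Finset.sum_filter, Finset.mul_sum, ← Finset.sum_add_distrib]
  refine Finset.sum_le_sum fun u _ => ?_
  have hgain : (finrank K (Submodule.span K (Set.range u)) : ℝ) +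
        (if Submodule.span K (Set.range u) ≠ ⊤ then γ else 0) ≤
      ∑ w, D w *
        finrank K (Submodule.span K (Set.range (Fin.cons w u : Fin (t + 1) → V))) := by
    calc _ ≤ (finrank K (Submodule.span K (Set.range u)) : ℝ) +
          ∑ w with w ∉ Submodule.span K (Set.range u), D w := by
          gcongr
          split_ifs with h
          · exact hγ _ h
          · exact Finset.sum_nonneg fun w _ => hD w
      _ = ∑ w, D w * (finrank K (Submodule.span K (Set.range u)) +
          if w ∉ Submodule.span K (Set.range u) then 1 else 0) := by
          simp_rw [mul_add, Finset.sum_add_distrib, ← Finset.sum_mul, hD1, mul_ite, mul_one,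
            mul_zero, Finset.sum_filter, one_mul]
      _ ≤ _ := by
          refine Finset.sum_le_sum fun w _ => mul_le_mul_of_nonneg_left ?_ (hD w)
          exact_mod_cast finrank_span_add_le_finrank_span_cons (K := K) w u
  have hprod : 0 ≤ ∏ i, D (u i) := Finset.prod_nonneg fun i _ => hD _
  calc _ = (∏ i, D (u i)) * ((finrank K (Submodule.span K (Set.range u)) : ℝ) +
        (if Submodule.span K (Set.range u) ≠ ⊤ then γ else 0)) := by
        split_ifs <;> ring
    _ ≤ _ := mul_le_mul_of_nonneg_left hgain hprod
    _ = _ := by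
        rw [Finset.mul_sum]
        refine Finset.sum_congr rfl fun w _ => ?_
        simp only [Fin.consEquiv_apply, Fin.prod_univ_succ, Fin.cons_zero, Fin.cons_succ]
        rw [mul_left_comm, mul_assoc]
        rfl

theorem mul_sum_prob_not_span_le_finrank (hD : ∀ w, 0 ≤ D w)
    (hD1 : ∑ w, D w = 1)
    (hγ : ∀ S : Submodule K V, S ≠ ⊤ → γ ≤ ∑ w with w ∉ S, D w) (N : ℕ) :
    γ * ∑ t ∈ Finset.range N,
        ∑ u : Fin t → V with Submodule.span K (Set.range u) ≠ ⊤, ∏ i, D (u i) ≤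
      finrank K V := by
  have hrank : γ * ∑ t ∈ Finset.range N,
        ∑ u : Fin t → V with Submodule.span K (Set.range u) ≠ ⊤, ∏ i, D (u i) ≤
      ∑ u : Fin N → V, (∏ i, D (u i)) * finrank K (Submodule.span K (Set.range u)) := by
    induction N with
    | zero => simp
    | succ N ih =>
      rw [Finset.sum_range_succ, mul_add]
      linarith [expected_finrank_span_succ hD hD1 hγ N]
  have htotal : ∑ u : Fin N → V, ∏ i, D (u i) = 1 := by
    rw [← Fintype.piFinset_univ, ← Finset.prod_univ_sum]
    simp [hD1]
  refine hrank.trans ?_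
  rw [← one_mul (finrank K V : ℝ), ← htotal, Finset.sum_mul]
  refine Finset.sum_le_sum fun u _ => mul_le_mul_of_nonneg_left ?_ ?_
  · exact_mod_cast Submodule.finrank_le _
  · exact Finset.prod_nonneg fun i _ => hD _

end ExpectedRank

open scoped Classical in
/-- Let `γ_f > 0` and draw i.i.d. samples `u_1, u_2, …` from the distribution
`D(u) = (F̂(u))²` on `Z_2^n`.
(1) For every `i` and every realization `u_1, …, u_i` with `Span{u_1,…,u_i} ≠ Z_2^n`, the
conditional probability that `u_{i+1} ∉ Span{u_1,…,u_i}` — which, by independence, is the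
`D`-mass `∑_{w ∉ Span} (F̂(w))²` of the complement of the span — is at least `γ_f`.
(2) Consequently, the expected number of samples until the span is all of `Z_2^n`, namely
`E[T] = ∑_{t ≥ 0} Pr[T > t]` where `Pr[T > t] = ∑_{u ∈ (Z_2^n)^t, Span{u_1,…,u_t} ≠ Z_2^n}
∏_i D(u_i)` (stated via all partial sums), is at most `n/γ_f`. -/
theorem sampling_spans_in_expected_time (n : ℕ) (hn : 1 ≤ n)
    (f : (Fin n → ZMod 2) → ZMod 2) (hγ : 0 < minInfluence n hn f) :
    (∀ (i : ℕ) (u : Fin i → Fin n → ZMod 2),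
        Submodule.span (ZMod 2) (Set.range u) ≠ ⊤ →
        ∑ w ∈ Finset.univ.filter fun w : Fin n → ZMod 2 =>
            w ∉ Submodule.span (ZMod 2) (Set.range u),
          (boolFourierCoeff n f w) ^ 2 ≥ minInfluence n hn f) ∧
      ∀ N : ℕ,
        ∑ t ∈ Finset.range N,
          ∑ u ∈ Finset.univ.filter fun u : Fin t → Fin n → ZMod 2 =>
              Submodule.span (ZMod 2) (Set.range u) ≠ ⊤,
            ∏ i, (boolFourierCoeff n f (u i)) ^ 2 ≤
          n / minInfluence n hn f := by
  refine ⟨fun i u hu => minInfluence_le_sum_notMem n hn f hu, fun N => ?_⟩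
  rw [le_div_iff₀' hγ]
  simpa using mul_sum_prob_not_span_le_finrank (K := ZMod 2) (fun w => sq_nonneg _)
    (sum_boolFourierCoeff_sq n f) (fun S hS => minInfluence_le_sum_notMem n hn f hS) N
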